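/- Let A be a symmetric real n×n matrix such that det(A − Λ) < 0 for every skew-symmetric real n×n matrix Λ. Then n is odd and A is negative definite. -/

import Mathlib

open Matrix

/-- If `x` is a nonzero isotropic vector of `A`, some skew-symmetric `S` agrees with `A` at `x`. -/
theorem exists_skew_det_sub_eq_zero {n : ℕ} (A : Matrix (Fin n) (Fin n) ℝ) {x : Fin n → ℝ}
    (hx : x ≠ 0) (hq : x ⬝ᵥ (A *ᵥ x) = 0) :
    ∃ S : Matrix (Fin n) (Fin n) ℝ, Sᵀ = -S ∧ (A - S).det = 0 := by
  have hxx : x ⬝ᵥ x ≠ 0 := fun h => hx (dotProduct_self_eq_zero.mp h)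
  refine ⟨(x ⬝ᵥ x)⁻¹ • (vecMulVec (A *ᵥ x) x - vecMulVec x (A *ᵥ x)), ?_, ?_⟩
  · rw [transpose_smul, transpose_sub, transpose_vecMulVec, transpose_vecMulVec, ← smul_neg,
      neg_sub]
  · refine exists_mulVec_eq_zero_iff.mp ⟨x, hx, ?_⟩
    have hq' : (A *ᵥ x) ⬝ᵥ x = 0 := by rw [dotProduct_comm, hq]
    ext i
    simp [sub_mulVec, smul_mulVec, vecMulVec_mulVec, hq', hxx]

/-- A quadratic form without nonzero isotropic vectors does not take both signs. -/
theorem exists_isotropic_of_pos_of_neg {n : ℕ} (A : Matrix (Fin n) (Fin n) ℝ) {x y : Fin n → ℝ}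
    (hx : 0 < x ⬝ᵥ (A *ᵥ x)) (hy : y ⬝ᵥ (A *ᵥ y) < 0) :
    ∃ z : Fin n → ℝ, z ≠ 0 ∧ z ⬝ᵥ (A *ᵥ z) = 0 := by
  let f : ℝ → ℝ := fun t => ((1 - t) • x + t • y) ⬝ᵥ (A *ᵥ ((1 - t) • x + t • y))
  have hf : Continuous f := by
    simp only [f, mulVec_add, mulVec_smul, add_dotProduct, dotProduct_add, smul_dotProduct,
      dotProduct_smul]
    fun_prop
  obtain ⟨t, -, ht⟩ : (0 : ℝ) ∈ f '' Set.Icc 0 1 :=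
    intermediate_value_Icc' zero_le_one hf.continuousOn
      ⟨by simpa [f] using hy.le, by simpa [f] using hx.le⟩
  refine ⟨_, fun hz => ?_, ht⟩
  have h : (1 - t) • x = -(t • y) := eq_neg_of_add_eq_zero_left hz
  have hq : (1 - t) ^ 2 * (x ⬝ᵥ (A *ᵥ x)) = t ^ 2 * (y ⬝ᵥ (A *ᵥ y)) := by
    have := congrArg (fun v => v ⬝ᵥ (A *ᵥ v)) h
    simp only [mulVec_neg, mulVec_smul, neg_dotProduct, dotProduct_neg, smul_dotProduct,
      dotProduct_smul, smul_eq_mul] at this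
    linarith
  rcases eq_or_ne t 0 with rfl | ht0
  · simp at hq
    linarith
  · have := mul_neg_of_pos_of_neg (pow_pos (abs_pos.mpr ht0) 2) hy
    rw [sq_abs] at this
    have := mul_nonneg (sq_nonneg (1 - t)) hx.le
    linarith

theorem negDef_of_skew_char_poly_neg (n : ℕ)
    (A : Matrix (Fin n) (Fin n) ℝ) (hA : Aᵀ = A)
    (hneg : ∀ Λ : Matrix (Fin n) (Fin n) ℝ, Λᵀ = -Λ → (A - Λ).det < 0) :
    Odd n ∧ (∀ x : Fin n → ℝ, x ≠ 0 → x ⬝ᵥ (A *ᵥ x) < 0) := by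
  have hiso : ∀ x : Fin n → ℝ, x ≠ 0 → x ⬝ᵥ (A *ᵥ x) ≠ 0 := fun x hx hq => by
    obtain ⟨S, hS, hdet⟩ := exists_skew_det_sub_eq_zero A hx hq
    exact (hneg S hS).ne hdet
  have hdet : A.det < 0 := by simpa using hneg 0 (by simp)
  have hherm : A.IsHermitian := by
    rw [IsHermitian, conjTranspose_eq_transpose_of_trivial, hA]
  have hnd : ∀ x : Fin n → ℝ, x ≠ 0 → x ⬝ᵥ (A *ᵥ x) < 0 := by
    by_contra! ⟨x, hx, hqx⟩
    have hpos : A.PosDef := PosDef.of_dotProduct_mulVec_pos hherm fun y hy => by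
      rw [star_trivial]
      by_contra! hqy
      obtain ⟨z, hz, hqz⟩ := exists_isotropic_of_pos_of_neg A
        (hqx.lt_of_ne' (hiso x hx)) (hqy.lt_of_ne (hiso y hy))
      exact hiso z hz hqz
    exact hdet.not_gt hpos.det_pos
  refine ⟨?_, hnd⟩
  have hpos : (-A).PosDef := PosDef.of_dotProduct_mulVec_pos hherm.neg fun y hy => by
    simpa [neg_mulVec] using hnd y hy
  by_contra hodd
  have h := hpos.det_pos
  rw [det_neg, Fintype.card_fin, (Nat.not_odd_iff_even.mp hodd).neg_one_pow, one_mul] at h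
  exact hdet.not_gt h
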